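/- arXiv:1212.6607 — 2 statements merged into one kernel-verified Lean document; each statement's English description precedes it below -/
import Mathlib

section
/- Let T=(Q,A,B,→,O,H) be a finite non-blocking alternating transition system, q₀∈Q, ∏:Q→2^P a valuation function, φ an LTL₋X(P) formula, 𝒜_φ=(S,{x₀},2^P,→_{𝒜_φ},F) a total Büchi automaton accepting exactly the infinite words over 2^P satisfying φ, and f₀ a control strategy of T such that every σ∈Out_T(q₀,f₀) satisfies φ w.r.t. ∏. Let f_T := f₀∘Υ_T. Then there exists n∈ℕ such that ReN(σ_T) ≤ n for all σ_T ∈ Out((q₀,x₀),f_T). -/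
/-! Common definitions: alternating transition systems, control strategies and
their outcomes, LTL₋X, reactive plans, Büchi automata, product automata,
the `ReN` function, and the accepting transition system `T_fin`.
All infinite sequences are modeled as functions `ℕ → X` (0-indexed: index `i`
corresponds to position `i+1` of the paper), finite non-empty sequences as
`List X`. -/

/-- Alternating transition system with states `Q`, control labels `A`,
disturbance labels `B` and observations `O`. -/
structure ATS (Q A B O : Type*) where
  trans : Q → A → B → Q → Prop
  obs : Q → O

namespace ATS

variable {Q A B O : Type*}

/-- `T` is non-blocking. -/
def NonBlocking (T : ATS Q A B O) : Prop :=
  ∀ q a b, ∃ q', T.trans q a b q'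

/-- `σ` is an (infinite) trajectory of `T`. -/
def Traj (T : ATS Q A B O) (σ : ℕ → Q) : Prop :=
  ∀ i, ∃ a b, T.trans (σ i) a b (σ (i + 1))

end ATS

/-- The prefix `σ[1,n]` (first `n` entries) of an infinite sequence. -/
def prefixSeq {X : Type*} (σ : ℕ → X) (n : ℕ) : List X :=
  (List.range n).map σ

/-- `s ∈ Out⁺_T(q,f)` : `s` is a (non-empty) finite outcome of the control
strategy `f` from `q`. -/
def FinOutcome {Q A B O : Type*} (T : ATS Q A B O) (f : List Q → A) (q : Q)
    (s : List Q) : Prop :=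
  s ≠ [] ∧ s.head? = some q ∧
    ∀ (i : ℕ) x y, s[i]? = some x → s[i + 1]? = some y →
      ∃ b, T.trans x (f (s.take (i + 1))) b y

/-- `σ ∈ Out_T(q,f)` : `σ` is an infinite outcome of the control strategy `f`
from `q`. -/
def InfOutcome {Q A B O : Type*} (T : ATS Q A B O) (f : List Q → A) (q : Q)
    (σ : ℕ → Q) : Prop :=
  σ 0 = q ∧ ∀ i, ∃ b, T.trans (σ i) (f (prefixSeq σ (i + 1))) b (σ (i + 1))

/-- LTL₋X formulas over atomic propositions `P`. -/
inductive LTL (P : Type*) where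
  | atom : P → LTL P
  | neg : LTL P → LTL P
  | conj : LTL P → LTL P → LTL P
  | until_ : LTL P → LTL P → LTL P

/-- Satisfaction of an LTL₋X formula at position `i` (0-indexed) of an infinite
word `w` over `2^P`. -/
def LTL.SatAt {P : Type*} (w : ℕ → Set P) : ℕ → LTL P → Prop
  | i, .atom p => p ∈ w i
  | i, .neg φ => ¬ LTL.SatAt w i φ
  | i, .conj φ ψ => LTL.SatAt w i φ ∧ LTL.SatAt w i ψ
  | i, .until_ φ ψ =>
      ∃ j, i ≤ j ∧ LTL.SatAt w j ψ ∧ ∀ k, i ≤ k → k < j → LTL.SatAt w k φ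

/-- `w ⊨ φ`. -/
def LTL.Sat {P : Type*} (w : ℕ → Set P) (φ : LTL P) : Prop :=
  LTL.SatAt w 0 φ

/-- `σ ⊨_∏ φ` for an infinite sequence of states and valuation `Pi`. -/
def SatTraj {Q P : Type*} (Pi : Q → Set P) (σ : ℕ → Q) (φ : LTL P) : Prop :=
  LTL.Sat (fun i => Pi (σ i)) φ

/-- A reactive plan with plan states `1,…,k` modeled as `Fin k`
(plan state 1 is `⟨0, hk⟩`), world-state labels `lab`, actions `act` and
successor sets `N`. -/
structure ReactivePlan (Q A : Type*) where
  k : ℕ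
  hk : 0 < k
  lab : Fin k → Q
  act : Fin k → A
  N : Fin k → Set (Fin k)

namespace ReactivePlan

variable {Q A : Type*}

/-- Plan state 1. -/
def one (RP : ReactivePlan Q A) : Fin RP.k := ⟨0, RP.hk⟩

/-- `σ` is a trajectory generated by `RP`. -/
def Traj (RP : ReactivePlan Q A) (σ : ℕ → Q) : Prop :=
  ∃ σN : ℕ → Fin RP.k, σN 0 = RP.one ∧
    ∀ j, σN (j + 1) ∈ RP.N (σN j) ∧ RP.lab (σN j) = σ j

/-- `s` is a finite path of `RP`. -/
def IsPath (RP : ReactivePlan Q A) (s : List (Fin RP.k)) : Prop :=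
  1 < s.length ∧ ∀ (i : ℕ) x y, s[i]? = some x → s[i + 1]? = some y → y ∈ RP.N x

/-- `RP` satisfies `φ` w.r.t. the valuation `Pi`. -/
def SatPlan {P : Type*} (RP : ReactivePlan Q A) (φ : LTL P) (Pi : Q → Set P) :
    Prop :=
  (∃ σ, RP.Traj σ) ∧ ∀ σ, RP.Traj σ → SatTraj Pi σ φ

/-- `RP` is a reactive plan of the alternating transition system `T`. -/
def OfATS {B O : Type*} (RP : ReactivePlan Q A) (T : ATS Q A B O) : Prop :=
  ∀ i, {x | ∃ j ∈ RP.N i, RP.lab j = x} =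
    {q' | ∃ b, T.trans (RP.lab i) (RP.act i) b q'}

/-- `sN` is a plan-state sequence matching the world-state sequence `s`:
it has the same length, starts in plan state 1, consecutive plan states are
successors, and labels agree with `s`. -/
def PlanMatch (RP : ReactivePlan Q A) (s : List Q) (sN : List (Fin RP.k)) :
    Prop :=
  sN.length = s.length ∧ sN.head? = some RP.one ∧
    (∀ (j : ℕ) x y, sN[j]? = some x → sN[j + 1]? = some y → y ∈ RP.N x) ∧
    (∀ (j : ℕ) x y, sN[j]? = some x → s[j]? = some y → y = RP.lab x)

/-- `f` is the control strategy generated by `RP`: on a sequence matched by a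
plan-state path it returns the action of the last plan state, otherwise the
action of plan state 1. -/
def IsGenStrategy (RP : ReactivePlan Q A) (f : List Q → A) : Prop :=
  ∀ s : List Q,
    (∀ sN x, RP.PlanMatch s sN → sN.getLast? = some x → f s = RP.act x) ∧
    ((¬ ∃ sN, RP.PlanMatch s sN) → f s = RP.act RP.one)

end ReactivePlan

/-- Büchi automaton with states `S` and input alphabet `L`. -/
structure Buchi (S L : Type*) where
  init : Set S
  trans : S → L → S → Prop
  acc : Set S

namespace Buchi

variable {S L : Type*}

/-- `σ` is a run accepted by `𝒜`. -/
def AccRun (𝒜 : Buchi S L) (σ : ℕ → S) : Prop :=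
  σ 0 ∈ 𝒜.init ∧ (∀ i, ∃ l, 𝒜.trans (σ i) l (σ (i + 1))) ∧
    ∃ x ∈ 𝒜.acc, ∀ n, ∃ m, n ≤ m ∧ σ m = x

/-- The infinite word `w` is accepted by `𝒜`. -/
def AccWord (𝒜 : Buchi S L) (w : ℕ → L) : Prop :=
  ∃ σ : ℕ → S, 𝒜.AccRun σ ∧ ∀ i, 𝒜.trans (σ i) (w i) (σ (i + 1))

/-- `𝒜` is total. -/
def Total (𝒜 : Buchi S L) : Prop :=
  (∃ x₀, 𝒜.init = {x₀}) ∧ ∀ x l, ∃! x', 𝒜.trans x l x'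

end Buchi

/-- Transition relation of the product automaton `𝒜^φ_{T,q₀}` on `Q × S`. -/
def ProdTrans {Q A B O S P : Type*} (T : ATS Q A B O) (𝒜 : Buchi S (Set P))
    (Pi : Q → Set P) : (Q × S) → A → B → (Q × S) → Prop :=
  fun p a b p' => T.trans p.1 a b p'.1 ∧ 𝒜.trans p.2 (Pi p.1) p'.2

/-- The product automaton viewed as an alternating transition system
(so that `Out`-sets for it are the ones of this system). -/
def ProdATS {Q A B O S P : Type*} (T : ATS Q A B O) (𝒜 : Buchi S (Set P))
    (Pi : Q → Set P) : ATS (Q × S) A B (Q × S) :=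
  { trans := ProdTrans T 𝒜 Pi, obs := id }

/-- The accepting set `F_T = Q × F` of the product automaton. -/
def ProdAcc (Q : Type*) {S P : Type*} (𝒜 : Buchi S (Set P)) : Set (Q × S) :=
  {p | p.2 ∈ 𝒜.acc}

/-- `σT` is a run accepted by the product automaton `𝒜^φ_{T,q₀}`. -/
def ProdAccRun {Q A B O S P : Type*} (T : ATS Q A B O) (𝒜 : Buchi S (Set P))
    (Pi : Q → Set P) (q₀ : Q) (x₀ : S) (σT : ℕ → Q × S) : Prop :=
  σT 0 = (q₀, x₀) ∧ (∀ i, ∃ a b, ProdTrans T 𝒜 Pi (σT i) a b (σT (i + 1))) ∧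
    ∃ p ∈ ProdAcc Q 𝒜, ∀ n, ∃ m, n ≤ m ∧ σT m = p

/-- The induced control strategy `f_T = f₀ ∘ Υ_T` of the product automaton. -/
def prodStrategy {Q A S : Type*} (f₀ : List Q → A) : List (Q × S) → A :=
  fun s => f₀ (s.map Prod.fst)

/-- `ReN` for finite sequences: the least index carrying a repeated occurrence
of an accepting state (`⊤` if there is none). -/
noncomputable def ReNList {X : Type*} (FT : Set X) (s : List X) : ℕ∞ :=
  sInf {e : ℕ∞ | ∃ n : ℕ, e = (n : ℕ∞) ∧
    ∃ i < n, ∃ y, s[i]? = some y ∧ s[n]? = some y ∧ y ∈ FT}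

/-- `ReN` for infinite sequences. -/
noncomputable def ReNFun {X : Type*} (FT : Set X) (σ : ℕ → X) : ℕ∞ :=
  sInf {e : ℕ∞ | ∃ n : ℕ, e = (n : ℕ∞) ∧ ∃ i < n, σ i = σ n ∧ σ n ∈ FT}

/-- The state set `S_f` of the accepting transition system `T_fin`: finite
outcomes of `f_T` from `(q₀,x₀)` in which every accepting state occurs at most
once. -/
def TfinStates {Q A B O S P : Type*} (T : ATS Q A B O) (𝒜 : Buchi S (Set P))
    (Pi : Q → Set P) (f₀ : List Q → A) (q₀ : Q) (x₀ : S) :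
    Set (List (Q × S)) :=
  {s | FinOutcome (ProdATS T 𝒜 Pi) (prodStrategy f₀) (q₀, x₀) s ∧
    ReNList (ProdAcc Q 𝒜) s = ⊤}

/-- The transition relation `→_f` of the accepting transition system `T_fin`
(with `step` the transition relation of the product automaton). -/
def TfinStep {X A' B' : Type*} (FT : Set X) (step : X → A' → B' → X → Prop)
    (fT : List X → A') (s : List X) (a : A') (s' : List X) : Prop :=
  a = fT s ∧ ∃ (p : X) (b : B') (lst : X), s.getLast? = some lst ∧
    step lst a b p ∧
    (s' = s ++ [p] ∨
      (ReNList FT (s ++ [p]) ≠ ⊤ ∧ s' ≠ s ++ [p] ∧ s' <+: (s ++ [p]) ∧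
        s'.getLast? = some p))

/-- `σT` is a trajectory of the accepting transition system `T_fin`. -/
def TfinTraj {X A' B' : Type*} (Sf : Set (List X)) (FT : Set X)
    (step : X → A' → B' → X → Prop) (fT : List X → A') (init : X)
    (σT : ℕ → X) : Prop :=
  ∃ seq : ℕ → List X, seq 0 = [init] ∧
    ∀ i, seq i ∈ Sf ∧ (seq i).getLast? = some (σT i) ∧
      ∃ a, TfinStep FT step fT (seq i) a (seq (i + 1))

/-- A predicate on sequences that only depends on finitely many entries defines an open set. -/
theorem isOpen_setOf_of_finite_dependence {X : Type*} [TopologicalSpace X] [DiscreteTopology X]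
    (p : (ℕ → X) → Prop) (n : ℕ)
    (h : ∀ σ τ : ℕ → X, (∀ i < n, τ i = σ i) → p σ → p τ) : IsOpen {σ | p σ} := by
  rw [isOpen_iff_mem_nhds]
  intro σ hσ
  exact Filter.mem_of_superset
    ((PiNat.isOpen_cylinder (fun _ => X) σ n).mem_nhds (PiNat.self_mem_cylinder σ n))
    fun τ hτ => h σ τ hτ hσ

theorem prefixSeq_congr {X : Type*} {σ τ : ℕ → X} {n : ℕ} (h : ∀ i < n, σ i = τ i) :
    prefixSeq σ n = prefixSeq τ n :=
  List.map_congr_left fun i hi => h i (List.mem_range.mp hi)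

/-- The infinite outcomes of a control strategy form a closed set of sequences. -/
theorem isClosed_setOf_infOutcome {Q A B O : Type*} [TopologicalSpace Q] [DiscreteTopology Q]
    (T : ATS Q A B O) (f : List Q → A) (q : Q) : IsClosed {σ | InfOutcome T f q σ} := by
  simp only [InfOutcome, Set.ofPred_and, Set.ofPred_forall]
  refine IsClosed.inter ?_ (isClosed_iInter fun i => ?_)
  · rw [← isOpen_compl_iff]
    refine isOpen_setOf_of_finite_dependence (fun σ => ¬ σ 0 = q) 1 fun σ τ h hσ => ?_
    rwa [h 0 one_pos]
  · rw [← isOpen_compl_iff]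
    refine isOpen_setOf_of_finite_dependence
      (fun σ => ¬ ∃ b, T.trans (σ i) (f (prefixSeq σ (i + 1))) b (σ (i + 1))) (i + 2)
      fun σ τ h hσ => ?_
    rwa [h i (by omega), h (i + 1) (by omega), prefixSeq_congr fun j hj => h j (by omega)]

/-- If every infinite outcome repeats some state of `F`, then finiteness of the state set bounds
uniformly the index of the first repetition. -/
theorem exists_forall_reNFun_le {Q A B O : Type*} [Finite Q] (T : ATS Q A B O) (f : List Q → A) (q : Q)
    (F : Set Q) (h : ∀ σ, InfOutcome T f q σ → ∃ n, ∃ i < n, σ i = σ n ∧ σ n ∈ F) :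
    ∃ n : ℕ, ∀ σ, InfOutcome T f q σ → ReNFun F σ ≤ (n : ℕ∞) := by
  let _ : TopologicalSpace Q := ⊥
  have : DiscreteTopology Q := ⟨rfl⟩
  obtain ⟨t, ht⟩ := (isClosed_setOf_infOutcome T f q).isCompact.elim_finite_subcover
    (fun n : ℕ => {σ : ℕ → Q | ∃ i < n, σ i = σ n ∧ σ n ∈ F})
    (fun n => isOpen_setOf_of_finite_dependence _ (n + 1) fun σ τ hστ => by
      rintro ⟨i, hi, hσ⟩
      exact ⟨i, hi, by rwa [hστ i (by omega), hστ n (by omega)]⟩)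
    (fun σ hσ => Set.mem_iUnion.mpr (h σ hσ))
  refine ⟨t.sup id, fun σ hσ => ?_⟩
  obtain ⟨n, hn, hrep⟩ := Set.mem_iUnion₂.mp (ht hσ)
  calc ReNFun F σ ≤ (n : ℕ∞) := sInf_le ⟨n, rfl, hrep⟩
    _ ≤ _ := by exact_mod_cast Finset.le_sup (f := id) hn

/-- A sequence over a finite set which visits `F` infinitely often repeats a state of `F`. -/
theorem exists_repeat_of_frequently {X : Type*} [Finite X] {F : Set X} {σ : ℕ → X}
    (h : ∀ n, ∃ m, n ≤ m ∧ σ m ∈ F) : ∃ n, ∃ i < n, σ i = σ n ∧ σ n ∈ F := by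
  have hinf : {m | σ m ∈ F}.Infinite := Set.infinite_of_forall_exists_gt fun n => by
    obtain ⟨m, hm, hF⟩ := h (n + 1)
    exact ⟨m, hF, hm⟩
  obtain ⟨i, hi, j, hj, hij, heq⟩ :=
    hinf.exists_lt_map_eq_of_mapsTo (Set.mapsTo_univ σ _) Set.finite_univ
  exact ⟨j, i, hij, heq, hj⟩

/-- Two runs of a total Büchi automaton over the same word coincide. -/
theorem Buchi.Total.run_unique {S L : Type*} {𝒜 : Buchi S L} (h : 𝒜.Total) {w : ℕ → L}
    {σ τ : ℕ → S} (h0 : σ 0 = τ 0) (hσ : ∀ i, 𝒜.trans (σ i) (w i) (σ (i + 1)))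
    (hτ : ∀ i, 𝒜.trans (τ i) (w i) (τ (i + 1))) : σ = τ := by
  funext i
  induction i with
  | zero => exact h0
  | succ i ih => exact (h.2 (σ i) (w i)).unique (hσ i) (ih ▸ hτ i)

/-- Outcomes of the product automaton project to outcomes of the transition system. -/
theorem InfOutcome.fst {Q A B O S P : Type*} {T : ATS Q A B O} {𝒜 : Buchi S (Set P)}
    {Pi : Q → Set P} {f₀ : List Q → A} {p : Q × S} {σT : ℕ → Q × S}
    (h : InfOutcome (ProdATS T 𝒜 Pi) (prodStrategy f₀) p σT) :
    InfOutcome T f₀ p.1 (fun i => (σT i).1) := by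
  refine ⟨congrArg Prod.fst h.1, fun i => ?_⟩
  obtain ⟨b, hb, -⟩ := h.2 i
  refine ⟨b, ?_⟩
  simpa [prodStrategy, prefixSeq, Function.comp_def] using hb

/-- Lemma A.2: there is a uniform bound `n` on `ReN(σ_T)`
over all infinite outcomes `σ_T` of `f_T` from `(q₀,x₀)`. -/
theorem stmt12 {Q A B O S P : Type*} [Finite Q] [Finite A] [Finite B]
    [Finite S] [Finite P]
    (T : ATS Q A B O) (hnb : T.NonBlocking) (q₀ : Q)
    (Pi : Q → Set P) (φ : LTL P)
    (𝒜 : Buchi S (Set P)) (x₀ : S) (hinit : 𝒜.init = {x₀})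
    (htot : 𝒜.Total)
    (hacc : ∀ w : ℕ → Set P, 𝒜.AccWord w ↔ LTL.Sat w φ)
    (f₀ : List Q → A)
    (hsat : ∀ σ : ℕ → Q, InfOutcome T f₀ q₀ σ → SatTraj Pi σ φ) :
    ∃ n : ℕ, ∀ σT : ℕ → Q × S,
      InfOutcome (ProdATS T 𝒜 Pi) (prodStrategy f₀) (q₀, x₀) σT →
      ReNFun (ProdAcc Q 𝒜) σT ≤ (n : ℕ∞) := by
  refine exists_forall_reNFun_le _ _ _ _ fun σT hσT => exists_repeat_of_frequently ?_
  obtain ⟨τ, ⟨hτ0, -, x, hx, hτx⟩, hτ⟩ := (hacc _).mpr (hsat _ hσT.fst)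
  rw [hinit, Set.mem_singleton_iff] at hτ0
  have hrun : (fun i => (σT i).2) = τ :=
    htot.run_unique ((congrArg Prod.snd hσT.1).trans hτ0.symm)
      (fun i => (hσT.2 i).choose_spec.2) hτ
  intro n
  obtain ⟨m, hm, hmx⟩ := hτx n
  refine ⟨m, hm, ?_⟩
  have : (σT m).2 = x := (congrFun hrun m).trans hmx
  rwa [ProdAcc, Set.mem_ofPred_eq, this]
end

section
/- Let T=(Q,A,B,→,O,H) be a finite non-blocking alternating transition system, q₀∈Q, ∏:Q→2^P a valuation function, φ an LTL₋X(P) formula, 𝒜_φ=(S,{x₀},2^P,→_{𝒜_φ},F) a total Büchi automaton accepting exactly the infinite words over 2^P satisfying φ, and f₀ a control strategy of T such that every σ∈Out_T(q₀,f₀) satisfies φ w.r.t. ∏. Let f_T := f₀∘Υ_T, let T_fin(𝒜^φ_{T,q₀},f_T)=(S_f,A,→_f,lab) be the accepting transition system w.r.t. 𝒜^φ_{T,q₀} and f_T, and let RP(T_fin) be the reactive plan derived from T_fin. Then every trajectory σ generated by RP(T_fin) satisfies φ w.r.t. ∏. -/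
theorem ReNList_ne_top_iff {X : Type*} {FT : Set X} {s : List X} :
    ReNList FT s ≠ ⊤ ↔
      ∃ n : ℕ, ∃ i < n, ∃ y, s[i]? = some y ∧ s[n]? = some y ∧ y ∈ FT := by
  rw [ne_eq, ReNList, sInf_eq_top]
  constructor
  · intro h
    push Not at h
    obtain ⟨_, ⟨n, rfl, hn⟩, -⟩ := h
    exact ⟨n, hn⟩
  · rintro ⟨n, hn⟩ h
    exact ENat.natCast_ne_top n (h _ ⟨n, rfl, hn⟩)

/-- If appending `p` creates the first repetition of a state in `FT`, then `p ∈ FT`. -/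
theorem mem_of_ReNList_append_ne_top {X : Type*} {FT : Set X} {s : List X} {p : X}
    (hs : ReNList FT s = ⊤) (hsp : ReNList FT (s ++ [p]) ≠ ⊤) : p ∈ FT := by
  obtain ⟨n, i, hin, y, hi, hn, hy⟩ := ReNList_ne_top_iff.mp hsp
  have hle : n < (s ++ [p]).length := (List.getElem?_eq_some_iff.mp hn).1
  rw [List.length_append, List.length_singleton] at hle
  rcases Nat.lt_succ_iff_lt_or_eq.mp hle with hlt | rfl
  · rw [List.getElem?_append_left hlt] at hn
    rw [List.getElem?_append_left (hin.trans hlt)] at hi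
    exact absurd hs (ReNList_ne_top_iff.mpr ⟨n, i, hin, y, hi, hn, hy⟩)
  · rw [List.getElem?_concat_length, Option.some.injEq] at hn
    exact hn ▸ hy

/-- A step of `T_fin` from `s` to `s'` follows a transition between the last states of `s` and
`s'`, and it either lengthens the sequence by one or ends in an accepting state. -/
theorem TfinStep.last {X A' B' : Type*} {FT : Set X} {step : X → A' → B' → X → Prop}
    {fT : List X → A'} {s s' : List X} {a : A'} (hs : ReNList FT s = ⊤)
    (h : TfinStep FT step fT s a s') :
    ∃ lst p, s.getLast? = some lst ∧ s'.getLast? = some p ∧ (∃ b, step lst a b p) ∧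
      (s'.length = s.length + 1 ∨ p ∈ FT) := by
  obtain ⟨-, p, b, lst, hl, hstep, rfl | ⟨hne, -, -, hp⟩⟩ := h
  · exact ⟨lst, p, hl, by simp, ⟨b, hstep⟩, Or.inl (by simp)⟩
  · exact ⟨lst, p, hl, hp, ⟨b, hstep⟩, Or.inr (mem_of_ReNList_append_ne_top hs hne)⟩

/-- A sequence in a finite type cannot eventually increase a natural-number-valued measure at
every step. -/
theorem exists_le_measure_ne_succ {ι : Type*} [Finite ι] (len : ι → ℕ) (u : ℕ → ι) (n : ℕ) :
    ∃ k, n ≤ k ∧ len (u (k + 1)) ≠ len (u k) + 1 := by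
  by_contra! h
  have hmono : StrictMono fun k => len (u (n + k)) :=
    strictMono_nat_of_lt_succ fun k => by
      have := h (n + k) (Nat.le_add_right n k)
      rw [← Nat.add_assoc]
      omega
  refine not_injective_infinite_finite (fun k => u (n + k)) fun a b hab => ?_
  exact hmono.injective (congrArg len hab)

theorem exists_mem_forall_exists_ge_eq {X : Type*} [Finite X] {F : Set X} {u : ℕ → X}
    (h : ∀ n, ∃ k, n ≤ k ∧ u k ∈ F) : ∃ x ∈ F, ∀ n, ∃ k, n ≤ k ∧ u k = x := by
  by_contra! hc
  choose! N hN using hc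
  obtain ⟨M, hM⟩ := (Set.finite_range N).bddAbove
  obtain ⟨k, hk, hF⟩ := h M
  exact hN (u k) hF k ((hM ⟨u k, rfl⟩).trans hk) rfl

/-- Theorem 5.13: every trajectory generated by the
reactive plan `RP(T_fin)` (built from any enumeration `e` of `S_f` with
`e 1 = (q₀,x₀)`) satisfies `φ` w.r.t. `∏`. -/
theorem stmt16 {Q A B O S P : Type*} [Finite Q] [Finite A] [Finite B]
    [Finite S] [Finite P]
    (T : ATS Q A B O) (hnb : T.NonBlocking) (q₀ : Q)
    (Pi : Q → Set P) (φ : LTL P)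
    (𝒜 : Buchi S (Set P)) (x₀ : S) (hinit : 𝒜.init = {x₀})
    (htot : 𝒜.Total)
    (hacc : ∀ w : ℕ → Set P, 𝒜.AccWord w ↔ LTL.Sat w φ)
    (f₀ : List Q → A)
    (hsat : ∀ σ : ℕ → Q, InfOutcome T f₀ q₀ σ → SatTraj Pi σ φ)
    (m : ℕ) (hm : 0 < m) (e : Fin m → List (Q × S))
    (hinj : Function.Injective e)
    (hrange : Set.range e = TfinStates T 𝒜 Pi f₀ q₀ x₀)
    (he0 : e ⟨0, hm⟩ = [(q₀, x₀)]) :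
    ∀ σ : ℕ → Q,
      (ReactivePlan.mk m hm
          (fun i => (((e i).getLast?).getD (q₀, x₀)).1)
          (fun i => prodStrategy f₀ (e i))
          (fun i => {j | TfinStep (ProdAcc Q 𝒜) (ProdTrans T 𝒜 Pi)
            (prodStrategy f₀) (e i) (prodStrategy f₀ (e i)) (e j)})).Traj σ →
      SatTraj Pi σ φ := by
  rintro σ ⟨σN, h0, hN⟩
  have hReN (i : Fin m) : ReNList (ProdAcc Q 𝒜) (e i) = ⊤ := by
    have hi : e i ∈ TfinStates T 𝒜 Pi f₀ q₀ x₀ := hrange ▸ Set.mem_range_self i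
    exact hi.2
  set α : ℕ → Q × S := fun n => ((e (σN n)).getLast?).getD (q₀, x₀) with hα
  have hασ (n : ℕ) : (α n).1 = σ n := (hN n).2
  have hα0 : α 0 = (q₀, x₀) := by
    have h0' : σN 0 = ⟨0, hm⟩ := h0
    simp [hα, h0', he0]
  have hstep (n : ℕ) : 𝒜.trans (α n).2 (Pi (σ n)) (α (n + 1)).2 ∧
      ((e (σN (n + 1))).length = (e (σN n)).length + 1 ∨ (α (n + 1)).2 ∈ 𝒜.acc) := by
    obtain ⟨lst, p, hl, hp, ⟨b, hb⟩, hlen⟩ := TfinStep.last (hReN (σN n)) (hN n).1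
    have h1 : α n = lst := by simp [hα, hl]
    have h2 : α (n + 1) = p := by simp [hα, hp]
    rw [← hασ n, h1, h2]
    exact ⟨hb.2, hlen⟩
  have hinf (n : ℕ) : ∃ k, n ≤ k ∧ (α k).2 ∈ 𝒜.acc := by
    obtain ⟨k, hk, hne⟩ := exists_le_measure_ne_succ (fun i => (e i).length) σN n
    exact ⟨k + 1, hk.trans k.le_succ, (hstep k).2.resolve_left hne⟩
  refine (hacc _).mp ⟨fun n => (α n).2, ⟨?_, fun n => ⟨_, (hstep n).1⟩,
    exists_mem_forall_exists_ge_eq hinf⟩, fun n => (hstep n).1⟩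
  simp [hα0, hinit]
end
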